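/- For every φ ∈ H* and every x ∈ H, ((T_a ∘ T_b ∘ T_a)²(φ))(x) = (μ^l(v^{-1})/μ^l(v)) · Σ_i φ(S^{-1}(a_i)·g^{-1}·v^{-1}·S(x)·b_i). -/

import Mathlib

/- STATEMENT 5: `((T_a∘T_b∘T_a)²(φ))(x) = (μˡ(v⁻¹)/μˡ(v)) Σᵢ φ(S⁻¹(aᵢ) g⁻¹ v⁻¹ S(x) bᵢ)`. -/

noncomputable section

open scoped TensorProduct
open TensorProduct

/-- Symmetric linear forms on `H`. -/
def IsSLF {H : Type} [Ring H] [Algebra ℂ H] (φ : Module.Dual ℂ H) : Prop :=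
  ∀ x y : H, φ (x * y) = φ (y * x)

/-- The convolution product on the dual of a Hopf algebra: `(φψ)(x) = φ(x')ψ(x'')`. -/
def conv {H : Type} [Ring H] [HopfAlgebra ℂ H] (φ ψ : Module.Dual ℂ H) :
    Module.Dual ℂ H :=
  LinearMap.mul' ℂ ℂ ∘ₗ TensorProduct.map φ ψ ∘ₗ (Coalgebra.comul (R := ℂ) (A := H))

/-- The operator `T_a(φ) = φ(v⁻¹ ?)`. -/
def Ta {H : Type} [Ring H] [Algebra ℂ H] (vinv : H) (φ : Module.Dual ℂ H) :
    Module.Dual ℂ H :=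
  φ ∘ₗ LinearMap.mulLeft ℂ vinv

/-- The operator `T_b(φ) = μˡ(v)⁻¹·[μˡ(g⁻¹v ?)·φ(v ?)](v⁻¹ ?)`. -/
def Tb {H : Type} [Ring H] [HopfAlgebra ℂ H] (μl : Module.Dual ℂ H)
    (v vinv gi : H) (φ : Module.Dual ℂ H) : Module.Dual ℂ H :=
  (μl v)⁻¹ • ((conv (μl ∘ₗ LinearMap.mulLeft ℂ (gi * v))
      (φ ∘ₗ LinearMap.mulLeft ℂ v)) ∘ₗ LinearMap.mulLeft ℂ vinv)

section RMatrix

variable {H : Type} [Ring H] [HopfAlgebra ℂ H] {ι : Type} [Fintype ι]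

local notation "S" => HopfAlgebra.antipode ℂ
local notation "Δ" => Coalgebra.comul (R := ℂ)
local notation "ε" => Coalgebra.counit (R := ℂ)

/-- A two-sided inverse of the antipode. -/
structure IsAntipodeInverse (T : H →ₗ[ℂ] H) : Prop where
  left : ∀ x : H, T (S x) = x
  right : ∀ x : H, S (T x) = x

theorem IsAntipodeInverse.map_mul {T : H →ₗ[ℂ] H} (hT : IsAntipodeInverse T) (x y : H) :
    T (x * y) = T y * T x := by
  rw [← hT.left (T y * T x), HopfAlgebra.antipode_mul_antidistrib, hT.right, hT.right]

theorem IsAntipodeInverse.map_one {T : H →ₗ[ℂ] H} (hT : IsAntipodeInverse T) : T 1 = 1 := by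
  simpa using hT.left 1

/-- The map `id ⊗ μ`, followed by the identification `H ⊗ ℂ = H`. -/
def applyRight (μ : Module.Dual ℂ H) : H ⊗[ℂ] H →ₗ[ℂ] H :=
  (TensorProduct.rid ℂ H).toLinearMap ∘ₗ LinearMap.lTensor H μ

@[simp]
theorem applyRight_tmul (μ : Module.Dual ℂ H) (p q : H) :
    applyRight μ (p ⊗ₜ q) = μ q • p := by
  simp [applyRight]

theorem applyRight_mul_left (μ : Module.Dual ℂ H) (h : H) (t : H ⊗[ℂ] H) :
    applyRight μ ((h ⊗ₜ 1) * t) = h * applyRight μ t := by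
  induction t with
  | zero => simp
  | tmul p q => simp
  | add s t hs ht => simp only [mul_add, map_add, hs, ht]

theorem applyRight_mul_right (μ : Module.Dual ℂ H) (h : H) (t : H ⊗[ℂ] H) :
    applyRight μ (t * (h ⊗ₜ 1)) = applyRight μ t * h := by
  induction t with
  | zero => simp
  | tmul p q => simp
  | add s t hs ht => simp only [add_mul, map_add, hs, ht]

theorem applyRight_comp_mulLeft (μ : Module.Dual ℂ H) (h : H) (t : H ⊗[ℂ] H) :
    applyRight (μ ∘ₗ LinearMap.mulLeft ℂ h) t = applyRight μ ((1 ⊗ₜ h) * t) := by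
  induction t with
  | zero => simp
  | tmul p q => simp
  | add s t hs ht => simp only [mul_add, map_add, hs, ht]

theorem applyRight_comp_mulRight (μ : Module.Dual ℂ H) (h : H) (t : H ⊗[ℂ] H) :
    applyRight (μ ∘ₗ LinearMap.mulRight ℂ h) t = applyRight μ (t * (1 ⊗ₜ h)) := by
  induction t with
  | zero => simp
  | tmul p q => simp
  | add s t hs ht => simp only [add_mul, map_add, hs, ht]

/-- The family `(aᵢ ⊗ bᵢ)` sums to an invertible R-matrix. -/
structure IsRMatrix (a b : ι → H) : Prop where
  isUnit : IsUnit (∑ i, a i ⊗ₜ[ℂ] b i : H ⊗[ℂ] H)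
  comm : ∀ x : H, (∑ i, a i ⊗ₜ[ℂ] b i) * Δ x
    = (TensorProduct.comm ℂ H H) (Δ x) * ∑ i, a i ⊗ₜ[ℂ] b i
  hex₁ : (∑ i, (Δ (a i)) ⊗ₜ[ℂ] b i) = ∑ i, ∑ j, (a i ⊗ₜ[ℂ] a j) ⊗ₜ[ℂ] (b i * b j)
  hex₂ : (∑ i, a i ⊗ₜ[ℂ] (Δ (b i))) = ∑ i, ∑ j, (a i * a j) ⊗ₜ[ℂ] (b j ⊗ₜ[ℂ] b i)

namespace IsRMatrix

variable {a b : ι → H} (hR : IsRMatrix a b)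
include hR

theorem sum_counit_left : ∑ i, ε (a i) • b i = 1 := by
  have h := congrArg (LinearMap.rTensor H
    ((TensorProduct.lid ℂ H).toLinearMap ∘ₗ LinearMap.rTensor H (ε : H →ₗ[ℂ] ℂ))) hR.hex₁
  simp only [map_sum, LinearMap.rTensor_tmul, LinearMap.comp_apply,
    Coalgebra.rTensor_counit_comul, LinearEquiv.coe_coe, TensorProduct.lid_tmul, one_smul] at h
  have h' : (1 ⊗ₜ[ℂ] ∑ i, ε (a i) • b i) * (∑ i, a i ⊗ₜ[ℂ] b i) = ∑ i, a i ⊗ₜ[ℂ] b i := by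
    refine Eq.trans ?_ h.symm
    rw [TensorProduct.tmul_sum, Finset.sum_mul_sum]
    refine Finset.sum_congr rfl fun i _ => Finset.sum_congr rfl fun j _ => ?_
    simp [TensorProduct.smul_tmul']
  have h1 := hR.isUnit.mul_right_cancel (h'.trans (one_mul _).symm)
  have h2 := congrArg ((TensorProduct.lid ℂ H).toLinearMap ∘ₗ LinearMap.rTensor H (ε : H →ₗ[ℂ] ℂ)) h1
  simpa [Algebra.TensorProduct.one_def] using h2

theorem sum_counit_right : ∑ i, ε (b i) • a i = 1 := by
  have h := congrArg (LinearMap.lTensor H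
    ((TensorProduct.lid ℂ H).toLinearMap ∘ₗ LinearMap.rTensor H (ε : H →ₗ[ℂ] ℂ))) hR.hex₂
  simp only [map_sum, LinearMap.rTensor_tmul, LinearMap.lTensor_tmul, LinearMap.comp_apply,
    Coalgebra.rTensor_counit_comul, LinearEquiv.coe_coe, TensorProduct.lid_tmul, one_smul] at h
  have h' : (∑ i, a i ⊗ₜ[ℂ] b i) * ((∑ i, ε (b i) • a i) ⊗ₜ[ℂ] 1) = ∑ i, a i ⊗ₜ[ℂ] b i := by
    refine Eq.trans ?_ h.symm
    rw [TensorProduct.sum_tmul, Finset.sum_mul_sum]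
    refine Finset.sum_congr rfl fun i _ => Finset.sum_congr rfl fun j _ => ?_
    simp [TensorProduct.smul_tmul']
  have h1 := hR.isUnit.mul_left_cancel (h'.trans (mul_one _).symm)
  have h2 := congrArg (applyRight (ε : H →ₗ[ℂ] ℂ)) h1
  simpa [Algebra.TensorProduct.one_def] using h2

theorem sum_antipode_mul : ∑ i, ∑ j, (S (a i) * a j) ⊗ₜ[ℂ] (b i * b j) = 1 := by
  have h := congrArg (LinearMap.rTensor H
    (LinearMap.mul' ℂ H ∘ₗ LinearMap.rTensor H (HopfAlgebra.antipode ℂ (A := H)))) hR.hex₁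
  simp only [map_sum, LinearMap.rTensor_tmul, LinearMap.comp_apply,
    HopfAlgebra.mul_antipode_rTensor_comul_apply, LinearMap.mul'_apply] at h
  have h1 := congrArg (fun y : H => (1 : H) ⊗ₜ[ℂ] y) hR.sum_counit_left
  rw [← h, Algebra.TensorProduct.one_def, ← h1, TensorProduct.tmul_sum]
  simp [Algebra.algebraMap_eq_smul_one, TensorProduct.smul_tmul]

theorem sum_mul_antipode : ∑ i, ∑ j, (a i * S (a j)) ⊗ₜ[ℂ] (b i * b j) = 1 := by
  have h := congrArg (LinearMap.rTensor H
    (LinearMap.mul' ℂ H ∘ₗ LinearMap.lTensor H (HopfAlgebra.antipode ℂ (A := H)))) hR.hex₁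
  simp only [map_sum, LinearMap.rTensor_tmul, LinearMap.lTensor_tmul, LinearMap.comp_apply,
    HopfAlgebra.mul_antipode_lTensor_comul_apply, LinearMap.mul'_apply] at h
  have h1 := congrArg (fun y : H => (1 : H) ⊗ₜ[ℂ] y) hR.sum_counit_left
  rw [← h, Algebra.TensorProduct.one_def, ← h1, TensorProduct.tmul_sum]
  simp [Algebra.algebraMap_eq_smul_one, TensorProduct.smul_tmul]

theorem sum_tmul_antipode_mul : ∑ i, ∑ j, (a i * a j) ⊗ₜ[ℂ] (S (b j) * b i) = 1 := by
  have h := congrArg (LinearMap.lTensor H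
    (LinearMap.mul' ℂ H ∘ₗ LinearMap.rTensor H (HopfAlgebra.antipode ℂ (A := H)))) hR.hex₂
  simp only [map_sum, LinearMap.rTensor_tmul, LinearMap.lTensor_tmul, LinearMap.comp_apply,
    HopfAlgebra.mul_antipode_rTensor_comul_apply, LinearMap.mul'_apply] at h
  have h1 := congrArg (fun y : H => y ⊗ₜ[ℂ] (1 : H)) hR.sum_counit_right
  rw [← h, Algebra.TensorProduct.one_def, ← h1, TensorProduct.sum_tmul]
  simp [Algebra.algebraMap_eq_smul_one, TensorProduct.smul_tmul]

theorem sum_tmul_mul_antipode : ∑ i, ∑ j, (a i * a j) ⊗ₜ[ℂ] (b j * S (b i)) = 1 := by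
  have h := congrArg (LinearMap.lTensor H
    (LinearMap.mul' ℂ H ∘ₗ LinearMap.lTensor H (HopfAlgebra.antipode ℂ (A := H)))) hR.hex₂
  simp only [map_sum, LinearMap.lTensor_tmul, LinearMap.comp_apply,
    HopfAlgebra.mul_antipode_lTensor_comul_apply, LinearMap.mul'_apply] at h
  have h1 := congrArg (fun y : H => y ⊗ₜ[ℂ] (1 : H)) hR.sum_counit_right
  rw [← h, Algebra.TensorProduct.one_def, ← h1, TensorProduct.sum_tmul]
  simp [Algebra.algebraMap_eq_smul_one, TensorProduct.smul_tmul]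

theorem antipode_left_mul_self :
    (∑ i, S (a i) ⊗ₜ[ℂ] b i) * (∑ i, a i ⊗ₜ[ℂ] b i) = 1 := by
  rw [Finset.sum_mul_sum]
  simpa using hR.sum_antipode_mul

theorem self_mul_antipode_left :
    (∑ i, a i ⊗ₜ[ℂ] b i) * (∑ i, S (a i) ⊗ₜ[ℂ] b i) = 1 := by
  rw [Finset.sum_mul_sum]
  simpa using hR.sum_mul_antipode

theorem swap_mul_swap_antipode :
    (∑ i, b i ⊗ₜ[ℂ] a i) * (∑ i, b i ⊗ₜ[ℂ] S (a i)) = 1 := by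
  simpa [Algebra.TensorProduct.one_def] using
    congrArg (Algebra.TensorProduct.comm ℂ H H) hR.self_mul_antipode_left

theorem swap_antipode_mul_swap :
    (∑ i, b i ⊗ₜ[ℂ] S (a i)) * (∑ i, b i ⊗ₜ[ℂ] a i) = 1 := by
  simpa [Algebra.TensorProduct.one_def] using
    congrArg (Algebra.TensorProduct.comm ℂ H H) hR.antipode_left_mul_self

theorem swap_comm (x : H) : (∑ i, b i ⊗ₜ[ℂ] a i) * (TensorProduct.comm ℂ H H) (Δ x)
    = Δ x * ∑ i, b i ⊗ₜ[ℂ] a i := by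
  have h := congrArg (Algebra.TensorProduct.comm ℂ H H) (hR.comm x)
  rw [map_mul, map_mul] at h
  have h1 : ∀ t : H ⊗[ℂ] H, Algebra.TensorProduct.comm ℂ H H (TensorProduct.comm ℂ H H t) = t :=
    (TensorProduct.comm ℂ H H).symm_apply_apply
  have h2 : ∀ t : H ⊗[ℂ] H, Algebra.TensorProduct.comm ℂ H H t = TensorProduct.comm ℂ H H t :=
    fun _ => rfl
  rw [h1, h2 (Δ x)] at h
  simpa using h

theorem hex₂_inv : (∑ i, b i ⊗ₜ[ℂ] (Δ (S (a i))))
    = ∑ i, ∑ j, (b i * b j) ⊗ₜ[ℂ] (S (a j) ⊗ₜ[ℂ] S (a i)) := by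
  have hZ : ∑ i, b i ⊗ₜ[ℂ] Δ (a i) = ∑ i, ∑ j, (b i * b j) ⊗ₜ[ℂ] (a i ⊗ₜ[ℂ] a j) := by
    simpa using congrArg (TensorProduct.comm ℂ (H ⊗[ℂ] H) H) hR.hex₁
  have hXZ : (∑ i, b i ⊗ₜ[ℂ] (Δ (S (a i)))) * (∑ i, b i ⊗ₜ[ℂ] Δ (a i)) = 1 := by
    have h := congrArg (LinearMap.lTensor H (Δ : H →ₗ[ℂ] H ⊗[ℂ] H)) hR.swap_antipode_mul_swap
    rw [Finset.sum_mul_sum] at h ⊢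
    simpa [Algebra.TensorProduct.one_def] using h
  have hZY : (∑ i, b i ⊗ₜ[ℂ] Δ (a i)) *
      (∑ i, ∑ j, (b i * b j) ⊗ₜ[ℂ] (S (a j) ⊗ₜ[ℂ] S (a i))) = 1 := by
    have h := hR.swap_mul_swap_antipode
    rw [Finset.sum_mul_sum] at h
    simp only [Algebra.TensorProduct.tmul_mul_tmul] at h
    rw [hZ]
    calc _ = ∑ i, ∑ l, ((b i ⊗ₜ[ℂ] (a i ⊗ₜ[ℂ] (1 : H))) *
          LinearMap.lTensor H (TensorProduct.mk ℂ H H 1)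
            (∑ j, ∑ k, (b j * b k) ⊗ₜ[ℂ] (a j * S (a k)))) *
          (b l ⊗ₜ[ℂ] (S (a l) ⊗ₜ[ℂ] (1 : H))) := by
          simp only [Finset.sum_mul, Finset.mul_sum, map_sum, LinearMap.lTensor_tmul,
            TensorProduct.mk_apply, Algebra.TensorProduct.tmul_mul_tmul, one_mul, mul_one, mul_assoc]
          rw [Finset.sum_congr rfl fun i _ => Finset.sum_comm, Finset.sum_comm]
          refine Finset.sum_congr rfl fun i _ => ?_
          rw [Finset.sum_comm]
          exact Finset.sum_congr rfl fun j _ => Finset.sum_comm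
      _ = 1 := by
          have h1 := congrArg (LinearMap.lTensor H ((TensorProduct.mk ℂ H H).flip 1)) h
          rw [h]
          simpa [Algebra.TensorProduct.one_def] using h1
  exact left_inv_eq_right_inv hXZ hZY

variable {T : H →ₗ[ℂ] H} (hT : IsAntipodeInverse T)
include hT

theorem sum_antipode_tmul_eq : ∑ i, S (a i) ⊗ₜ[ℂ] b i = ∑ i, a i ⊗ₜ[ℂ] T (b i) := by
  have h := congrArg (LinearMap.lTensor H T) hR.sum_tmul_mul_antipode
  simp only [map_sum, LinearMap.lTensor_tmul, hT.map_mul, hT.left,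
    Algebra.TensorProduct.one_def, hT.map_one] at h
  have h' : (∑ i, a i ⊗ₜ[ℂ] b i) * (∑ i, a i ⊗ₜ[ℂ] T (b i)) = 1 := by
    rw [Finset.sum_mul_sum, Algebra.TensorProduct.one_def]
    simpa using h
  exact left_inv_eq_right_inv hR.antipode_left_mul_self h'

theorem sum_antipode_tmul_antipode :
    ∑ i, S (a i) ⊗ₜ[ℂ] S (b i) = ∑ i, a i ⊗ₜ[ℂ] b i := by
  have h := congrArg (LinearMap.lTensor H (HopfAlgebra.antipode ℂ (A := H)))
    (hR.sum_antipode_tmul_eq hT)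
  simpa [hT.right] using h

theorem sum_mul_inv : ∑ i, ∑ j, (a i * T (a j)) ⊗ₜ[ℂ] (b j * b i) = 1 := by
  have h := congrArg (LinearMap.rTensor H T) hR.sum_mul_antipode
  simp only [map_sum, LinearMap.rTensor_tmul, hT.map_mul, hT.left,
    Algebra.TensorProduct.one_def, hT.map_one] at h
  rw [Finset.sum_comm]
  exact h

end IsRMatrix

/-- The data of an R-matrix `Σ aᵢ ⊗ bᵢ`, a ribbon element `v` with inverse `w`, and a pivotal element
`g` with inverse `k`, where `T` is the inverse of the antipode. -/
structure IsRibbonDatum (T : H →ₗ[ℂ] H) (a b : ι → H) (v w g k : H) : Prop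
    extends IsRMatrix a b where
  antipodeInverse : IsAntipodeInverse T
  mul_inv : v * w = 1
  inv_mul : w * v = 1
  central : ∀ x : H, v * x = x * v
  antipode_ribbon : S v = v
  ribbon : (∑ i, b i ⊗ₜ[ℂ] a i) * ((∑ i, a i ⊗ₜ[ℂ] b i) * Δ v) = v ⊗ₜ[ℂ] v
  pivotal_mul_inv : g * k = 1
  pivotal_inv_mul : k * g = 1
  comul_pivotal : Δ g = g ⊗ₜ[ℂ] g
  comul_pivotal_inv : Δ k = k ⊗ₜ[ℂ] k
  antipode_pivotal : S g = k
  antipode_pivotal_inv : S k = g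
  antipode_sq : ∀ x : H, S (S x) * g = g * x
  drinfeld : ∑ i, S (b i) * a i = g * v

/-- The map `x ↦ f(x') x''`. -/
def coactLeft (f : Module.Dual ℂ H) : H →ₗ[ℂ] H :=
  applyRight f ∘ₗ (TensorProduct.comm ℂ H H).toLinearMap ∘ₗ Δ

namespace IsRibbonDatum

variable {T : H →ₗ[ℂ] H} {a b : ι → H} {v w g k : H} (D : IsRibbonDatum T a b v w g k)
include D

theorem inv_central (x : H) : w * x = x * w := by
  calc w * x = w * (x * (v * w)) := by rw [D.mul_inv, mul_one]
    _ = w * (x * v) * w := by simp only [mul_assoc]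
    _ = w * (v * x) * w := by rw [D.central]
    _ = x * w := by rw [← mul_assoc, D.inv_mul, one_mul]

theorem antipode_inv : S w = w := by
  have h : S w * v = 1 := by
    have := congrArg (HopfAlgebra.antipode ℂ) D.mul_inv
    rwa [HopfAlgebra.antipode_mul_antidistrib, D.antipode_ribbon, HopfAlgebra.antipode_one] at this
  exact left_inv_eq_right_inv h D.mul_inv

theorem inv_ribbon : T v = v := by
  conv_lhs => rw [← D.antipode_ribbon]
  exact D.antipodeInverse.left v

theorem inv_pivotal : T g = k := by
  rw [← D.antipode_pivotal_inv, D.antipodeInverse.left]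

theorem antipode_mul_pivotal (x : H) : S x * g = g * T x := by
  rw [← D.antipode_sq (T x), D.antipodeInverse.right]

theorem pivotal_inv_mul_antipode (x : H) : k * S x = T x * k := by
  have h := D.antipode_mul_pivotal x
  calc k * S x = k * (S x * g) * k := by
        rw [mul_assoc, mul_assoc, D.pivotal_mul_inv, mul_one]
    _ = T x * k := by rw [h, ← mul_assoc, D.pivotal_inv_mul, one_mul]

theorem sum_inv_mul : ∑ i, T (a i) * b i = k * v := by
  have h := congrArg T D.drinfeld
  simpa [D.antipodeInverse.map_mul, D.antipodeInverse.left, D.inv_ribbon, D.inv_pivotal,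
    D.central] using h

theorem sum_mul_antipode_self : ∑ i, a i * S (b i) = k * v := by
  have h := congrArg (LinearMap.mul' ℂ H ∘ₗ LinearMap.rTensor H T)
    (D.sum_antipode_tmul_antipode D.antipodeInverse)
  simpa [D.antipodeInverse.left, D.sum_inv_mul] using h

theorem comul_mul_comul_inv : Δ v * Δ w = 1 := by
  rw [← Bialgebra.comul_mul, D.mul_inv, Bialgebra.comul_one]

theorem swap_mul_self :
    (∑ i, b i ⊗ₜ[ℂ] a i) * (∑ i, a i ⊗ₜ[ℂ] b i) = (v ⊗ₜ v) * Δ w := by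
  rw [← D.ribbon, mul_assoc, mul_assoc, D.comul_mul_comul_inv, mul_one]

theorem self_mul_swap : (∑ i, a i ⊗ₜ[ℂ] b i) * (∑ i, b i ⊗ₜ[ℂ] a i)
    = (v ⊗ₜ v) * Algebra.TensorProduct.comm ℂ H H (Δ w) := by
  simpa using congrArg (Algebra.TensorProduct.comm ℂ H H) D.swap_mul_self

theorem comm_comul_inv : Algebra.TensorProduct.comm ℂ H H (Δ w)
    = (w ⊗ₜ w) * ((∑ i, a i ⊗ₜ[ℂ] b i) * (∑ i, b i ⊗ₜ[ℂ] a i)) := by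
  rw [D.self_mul_swap, ← mul_assoc, Algebra.TensorProduct.tmul_mul_tmul, D.inv_mul,
    ← Algebra.TensorProduct.one_def, one_mul]

theorem sum_mul_apply_right_factor (M : H ⊗[ℂ] H →ₗ[ℂ] H)
    (hM : ∀ (h : H) (s : H ⊗[ℂ] H), M ((h ⊗ₜ 1) * s) = h * M s) (t : H ⊗[ℂ] H) :
    ∑ i, a i * M ((1 ⊗ₜ b i) * t) = ∑ i, a i * (k * v) * M (Δ (b i) * t) := by
  have h₁ := congrArg (LinearMap.mul' ℂ H ∘ₗ TensorProduct.map
    (LinearMap.mulRight ℂ (k * v)) (M ∘ₗ LinearMap.mulRight ℂ t)) D.hex₂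
  simp only [map_sum, LinearMap.comp_apply, TensorProduct.map_tmul, LinearMap.mulRight_apply,
    LinearMap.mul'_apply] at h₁
  have h₂ : ∀ i, ∑ j, ∑ l, a j * a l * M (((S (b l) * b j) ⊗ₜ b i) * t)
      = M ((1 ⊗ₜ b i) * t) := fun i => by
    have h := congrArg (LinearMap.mul' ℂ H ∘ₗ LinearMap.lTensor H
      (M ∘ₗ LinearMap.mulRight ℂ t ∘ₗ (TensorProduct.mk ℂ H H).flip (b i))) D.sum_tmul_antipode_mul
    simpa [Algebra.TensorProduct.one_def] using h
  rw [h₁]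
  refine Finset.sum_congr rfl fun i _ => ?_
  rw [← h₂, Finset.mul_sum]
  refine Finset.sum_congr rfl fun j _ => ?_
  rw [← D.sum_mul_antipode_self, Finset.mul_sum, Finset.mul_sum, Finset.sum_mul]
  refine Finset.sum_congr rfl fun l _ => ?_
  have h : (S (b l) * b j) ⊗ₜ[ℂ] b i * t = (S (b l) ⊗ₜ 1) * (b j ⊗ₜ b i * t) := by
    rw [← mul_assoc, Algebra.TensorProduct.tmul_mul_tmul, one_mul]
  rw [h, hM]
  simp only [mul_assoc]

theorem sum_apply_left_factor_mul (M : H ⊗[ℂ] H →ₗ[ℂ] H)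
    (hM : ∀ (h : H) (s : H ⊗[ℂ] H), M (s * (h ⊗ₜ 1)) = M s * h) (t : H ⊗[ℂ] H) :
    ∑ i, M (t * (1 ⊗ₜ a i)) * b i = ∑ i, M (t * Δ (a i)) * (k * v * b i) := by
  have h₁ := congrArg (LinearMap.mul' ℂ H ∘ₗ TensorProduct.map
    (M ∘ₗ LinearMap.mulLeft ℂ t) (LinearMap.mulLeft ℂ (k * v))) D.hex₁
  simp only [map_sum, LinearMap.comp_apply, TensorProduct.map_tmul, LinearMap.mulLeft_apply,
    LinearMap.mul'_apply] at h₁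
  have h₂ : ∀ i, ∑ j, ∑ l, M (t * ((a j * T (a l)) ⊗ₜ a i)) * (b l * b j)
      = M (t * (1 ⊗ₜ a i)) := fun i => by
    have h := congrArg (LinearMap.mul' ℂ H ∘ₗ LinearMap.rTensor H
      (M ∘ₗ LinearMap.mulLeft ℂ t ∘ₗ (TensorProduct.mk ℂ H H).flip (a i)))
      (D.sum_mul_inv D.antipodeInverse)
    simpa [Algebra.TensorProduct.one_def] using h
  rw [h₁, Finset.sum_comm]
  refine Finset.sum_congr rfl fun i _ => ?_
  rw [← h₂, Finset.sum_mul]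
  refine Finset.sum_congr rfl fun j _ => ?_
  rw [← D.sum_inv_mul, Finset.sum_mul, Finset.sum_mul, Finset.mul_sum]
  refine Finset.sum_congr rfl fun l _ => ?_
  have h : t * (a j * T (a l)) ⊗ₜ[ℂ] a i = (t * a j ⊗ₜ a i) * (T (a l) ⊗ₜ 1) := by
    rw [mul_assoc, Algebra.TensorProduct.tmul_mul_tmul, mul_one]
  rw [h, hM]
  simp only [mul_assoc]

variable {μ : Module.Dual ℂ H} (hμ : ∀ x : H, applyRight μ (Δ x) = μ x • (1 : H))
include hμ

theorem coactLeft_integral (z : H) :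
    coactLeft (μ ∘ₗ LinearMap.mulLeft ℂ (k * v)) (w * z)
      = ∑ i, ∑ j, μ (k * b i * z * a j) • (v * a i * k * b j) := by
  have h₁ : coactLeft (μ ∘ₗ LinearMap.mulLeft ℂ (k * v)) (w * z)
      = applyRight μ ((1 ⊗ₜ (k * v)) * Algebra.TensorProduct.comm ℂ H H (Δ (w * z))) :=
    applyRight_comp_mulLeft _ _ _
  have h₂ : ((1 : H) ⊗ₜ[ℂ] (k * v)) * Algebra.TensorProduct.comm ℂ H H (Δ (w * z))
      = ∑ i, ∑ j, ((w * a i) ⊗ₜ 1) * ((1 ⊗ₜ k) * ((1 ⊗ₜ b i) * (Δ z * (1 ⊗ₜ a j))))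
        * (b j ⊗ₜ 1) := by
    have hz : (∑ i, b i ⊗ₜ[ℂ] a i) * Algebra.TensorProduct.comm ℂ H H (Δ z)
      = Δ z * ∑ i, b i ⊗ₜ[ℂ] a i := D.swap_comm z
    rw [Bialgebra.comul_mul, map_mul, D.comm_comul_inv, mul_assoc, mul_assoc, hz]
    simp only [Finset.sum_mul, Finset.mul_sum]
    rw [Finset.sum_comm]
    refine Finset.sum_congr rfl fun i _ => Finset.sum_congr rfl fun j _ => ?_
    have e₁ : (b j ⊗ₜ[ℂ] a j) = (1 ⊗ₜ a j) * (b j ⊗ₜ 1) := by simp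
    have e₂ : ((1 : H) ⊗ₜ[ℂ] (k * v)) * ((w ⊗ₜ w) * a i ⊗ₜ b i)
        = ((w * a i) ⊗ₜ 1) * ((1 ⊗ₜ k) * (1 ⊗ₜ b i)) := by
      simp only [Algebra.TensorProduct.tmul_mul_tmul, one_mul, mul_one]
      rw [mul_assoc k v, ← mul_assoc v w, D.mul_inv, one_mul]
    rw [e₁]
    simp only [← mul_assoc] at e₂ ⊢
    rw [e₂]
  have h₃ : ∀ x, applyRight μ ((1 ⊗ₜ k) * Δ x) = μ (k * x) • g := fun x => by
    have e : ((1 : H) ⊗ₜ[ℂ] k) * Δ x = (g ⊗ₜ 1) * Δ (k * x) := by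
      rw [Bialgebra.comul_mul, D.comul_pivotal_inv, ← mul_assoc,
        Algebra.TensorProduct.tmul_mul_tmul, D.pivotal_mul_inv, one_mul]
    rw [e, applyRight_mul_left, hμ, mul_smul_comm, mul_one]
  let M : H ⊗[ℂ] H →ₗ[ℂ] H := applyRight μ ∘ₗ LinearMap.mulLeft ℂ (1 ⊗ₜ k)
  have hM : ∀ t, M t = applyRight μ ((1 ⊗ₜ k) * t) := fun _ => rfl
  have hMl : ∀ (h : H) (s : H ⊗[ℂ] H), M ((h ⊗ₜ 1) * s) = h * M s := fun h s => by
    rw [hM, hM, ← applyRight_mul_left, ← mul_assoc, ← mul_assoc]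
    simp
  have hMr : ∀ (h : H) (s : H ⊗[ℂ] H), M (s * (h ⊗ₜ 1)) = M s * h := fun h s => by
    rw [hM, hM, ← applyRight_mul_right, mul_assoc]
  calc _ = ∑ j, w * (∑ i, a i * M ((1 ⊗ₜ b i) * (Δ z * (1 ⊗ₜ a j)))) * b j := by
        rw [h₁, h₂]
        simp only [map_sum, applyRight_mul_right, applyRight_mul_left, Finset.mul_sum,
          Finset.sum_mul, hM]
        rw [Finset.sum_comm]
        simp only [mul_assoc]
    _ = ∑ i, w * (a i * (k * v) * ∑ j, M (Δ (b i * z) * (1 ⊗ₜ a j)) * b j) := by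
        simp only [D.sum_mul_apply_right_factor M hMl]
        simp only [Finset.mul_sum, Finset.sum_mul, Bialgebra.comul_mul, mul_assoc]
        rw [Finset.sum_comm]
    _ = ∑ i, w * (a i * (k * v) * ∑ j, (μ (k * b i * z * a j) • g) * (k * v * b j)) := by
        refine Finset.sum_congr rfl fun i _ => ?_
        rw [D.sum_apply_left_factor_mul M hMr (Δ (b i * z))]
        simp only [← Bialgebra.comul_mul, hM, h₃]
        simp only [mul_assoc]
    _ = _ := by
        refine Finset.sum_congr rfl fun i _ => ?_
        rw [Finset.mul_sum, Finset.mul_sum]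
        refine Finset.sum_congr rfl fun j _ => ?_
        rw [smul_mul_assoc, mul_smul_comm, mul_smul_comm]
        congr 1
        calc w * (a i * (k * v) * (g * (k * v * b j)))
            = w * (a i * (k * v) * ((g * k) * v * b j)) := by simp only [mul_assoc]
          _ = w * (a i * k * v * (v * b j)) := by
              rw [D.pivotal_mul_inv, one_mul]; simp only [mul_assoc]
          _ = w * (v * (v * (a i * k) * b j)) := by
              rw [← D.central (a i * k)]
              rw [← mul_assoc _ v, ← D.central (v * (a i * k))]
              simp only [mul_assoc]
          _ = v * a i * k * b j := by
              rw [← mul_assoc w, D.inv_mul, one_mul]; simp only [mul_assoc]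

end IsRibbonDatum

theorem rTensor_assoc_symm_comul (N : H ⊗[ℂ] H →ₗ[ℂ] H)
    (hN : ∀ x : H, N (Δ x) = algebraMap ℂ H (ε x)) (h : H) :
    LinearMap.rTensor H N ((TensorProduct.assoc ℂ H H H).symm
      (LinearMap.lTensor H (Δ : H →ₗ[ℂ] H ⊗[ℂ] H) (Δ h))) = 1 ⊗ₜ h := by
  have hN' : N ∘ₗ (Δ : H →ₗ[ℂ] H ⊗[ℂ] H) = Algebra.linearMap ℂ H ∘ₗ (ε : H →ₗ[ℂ] ℂ) :=
    LinearMap.ext hN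
  rw [Coalgebra.coassoc_symm_apply, ← LinearMap.rTensor_comp_apply, hN',
    LinearMap.rTensor_comp_apply, Coalgebra.rTensor_counit_comul]
  simp

section Integral

variable {μ : Module.Dual ℂ H} (hμ : ∀ x : H, applyRight μ (Δ x) = μ x • (1 : H))
include hμ

theorem applyRight_mul_comul (h x : H) : applyRight μ ((1 ⊗ₜ h) * Δ x)
    = S (applyRight (μ ∘ₗ LinearMap.mulRight ℂ x) (Δ h)) := by
  rw [← rTensor_assoc_symm_comul (LinearMap.mul' ℂ H ∘ₗ
    LinearMap.rTensor H (HopfAlgebra.antipode ℂ (A := H)))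
    (fun y => HopfAlgebra.mul_antipode_rTensor_comul_apply y) h]
  generalize Δ h = t
  induction t with
  | zero => simp
  | add s t hs ht => simp only [map_add, add_mul, hs, ht]
  | tmul p q =>
    have e : LinearMap.rTensor H (LinearMap.mul' ℂ H ∘ₗ
        LinearMap.rTensor H (HopfAlgebra.antipode ℂ (A := H)))
        ((TensorProduct.assoc ℂ H H H).symm
          (LinearMap.lTensor H (Δ : H →ₗ[ℂ] H ⊗[ℂ] H) (p ⊗ₜ q))) = (S p ⊗ₜ 1) * Δ q := by
      rw [LinearMap.lTensor_tmul]
      generalize Δ q = s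
      induction s with
      | zero => simp
      | tmul q r => simp
      | add s t hs ht => simp only [TensorProduct.tmul_add, map_add, mul_add, hs, ht]
    rw [e, mul_assoc, ← Bialgebra.comul_mul, applyRight_mul_left, hμ]
    simp

theorem applyRight_comul_mul {T : H →ₗ[ℂ] H} (hT : IsAntipodeInverse T) (h x : H) :
    applyRight μ (Δ x * (1 ⊗ₜ h)) = T (applyRight (μ ∘ₗ LinearMap.mulLeft ℂ x) (Δ h)) := by
  have hN : ∀ y : H, (LinearMap.mul' ℂ H ∘ₗ (TensorProduct.comm ℂ H H).toLinearMap ∘ₗ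
      LinearMap.rTensor H T) (Δ y) = algebraMap ℂ H (ε y) := fun y => by
    rw [← hT.left (algebraMap ℂ H (ε y)), Algebra.algebraMap_eq_smul_one, map_smul,
      HopfAlgebra.antipode_one, ← Algebra.algebraMap_eq_smul_one,
      ← HopfAlgebra.mul_antipode_lTensor_comul_apply]
    generalize Δ y = t
    induction t with
    | zero => simp
    | tmul p q => simp [hT.map_mul, hT.left]
    | add s t hs ht => simp only [map_add, hs, ht]
  rw [← rTensor_assoc_symm_comul _ hN h]
  generalize Δ h = t
  induction t with
  | zero => simp
  | add s t hs ht => simp only [map_add, mul_add, hs, ht]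
  | tmul p q =>
    have e : LinearMap.rTensor H (LinearMap.mul' ℂ H ∘ₗ
        (TensorProduct.comm ℂ H H).toLinearMap ∘ₗ LinearMap.rTensor H T)
        ((TensorProduct.assoc ℂ H H H).symm
          (LinearMap.lTensor H (Δ : H →ₗ[ℂ] H ⊗[ℂ] H) (p ⊗ₜ q))) = Δ q * (T p ⊗ₜ 1) := by
      rw [LinearMap.lTensor_tmul]
      generalize Δ q = s
      induction s with
      | zero => simp
      | tmul q r => simp
      | add s t hs ht => simp only [TensorProduct.tmul_add, map_add, add_mul, hs, ht]
    rw [e, ← mul_assoc, ← Bialgebra.comul_mul, applyRight_mul_right, hμ]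
    simp

end Integral

namespace IsRibbonDatum

variable {T : H →ₗ[ℂ] H} {a b : ι → H} {v w g k : H} (D : IsRibbonDatum T a b v w g k)
include D

theorem tmul_ribbon_central (t : H ⊗[ℂ] H) : (v ⊗ₜ v) * t = t * (v ⊗ₜ v) := by
  induction t with
  | zero => simp
  | tmul p q => simp [D.central]
  | add s t hs ht => rw [mul_add, add_mul, hs, ht]

theorem sum_mul_antipode_sq : ∑ i, b i * S (S (a i)) = k * w := by
  have h := congrArg (LinearMap.mul' ℂ H ∘ₗ (TensorProduct.comm ℂ H H).toLinearMap)
    D.sum_tmul_mul_antipode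
  simp only [map_sum, LinearMap.comp_apply, LinearEquiv.coe_coe, TensorProduct.comm_tmul,
    LinearMap.mul'_apply, Algebra.TensorProduct.one_def, mul_one] at h
  have h₁ : (∑ i, b i * S (S (a i))) * (g * v) = 1 := by
    rw [← h, Finset.sum_comm, Finset.sum_mul]
    refine Finset.sum_congr rfl fun j _ => ?_
    have e : ∑ i, b j * S (b i) * (a i * a j) = b j * (∑ i, S (b i) * a i) * a j := by
      simp only [Finset.mul_sum, Finset.sum_mul, mul_assoc]
    rw [e, D.drinfeld, mul_assoc, ← mul_assoc _ g v, D.antipode_sq, mul_assoc, mul_assoc,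
      mul_assoc, D.central]
  have h₂ : (g * v) * (k * w) = 1 := by
    rw [mul_assoc, ← mul_assoc v, D.central k, mul_assoc, D.mul_inv, mul_one, D.pivotal_mul_inv]
  exact left_inv_eq_right_inv h₁ h₂

theorem dual : IsRibbonDatum T b (fun i => S (a i)) w v g k where
  isUnit := ⟨⟨_, _, D.swap_antipode_mul_swap, D.swap_mul_swap_antipode⟩, rfl⟩
  comm x := by
    have h := congrArg (fun t => (∑ i, b i ⊗ₜ[ℂ] S (a i)) * t * (∑ i, b i ⊗ₜ[ℂ] S (a i)))
      (D.swap_comm x)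
    simp only [← mul_assoc, D.swap_antipode_mul_swap, one_mul] at h
    rw [h, mul_assoc, D.swap_mul_swap_antipode, mul_one]
  hex₁ := by
    have h := congrArg (LinearMap.lTensor (H ⊗[ℂ] H) (HopfAlgebra.antipode ℂ (A := H)) ∘ₗ
      (TensorProduct.comm ℂ H (H ⊗[ℂ] H)).toLinearMap) D.hex₂
    simp only [map_sum, LinearMap.comp_apply, LinearEquiv.coe_coe, TensorProduct.comm_tmul,
      LinearMap.lTensor_tmul, HopfAlgebra.antipode_mul_antidistrib] at h
    rw [h, Finset.sum_comm]
  hex₂ := D.hex₂_inv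
  antipodeInverse := D.antipodeInverse
  mul_inv := D.inv_mul
  inv_mul := D.mul_inv
  central := D.inv_central
  antipode_ribbon := D.antipode_inv
  ribbon := by
    have h : (∑ i, S (a i) ⊗ₜ[ℂ] b i) * ((∑ i, b i ⊗ₜ[ℂ] S (a i)) * ((v ⊗ₜ v) * Δ w)) = 1 := by
      rw [← D.swap_mul_self, ← mul_assoc (∑ i, b i ⊗ₜ[ℂ] S (a i)), D.swap_antipode_mul_swap,
        one_mul, D.antipode_left_mul_self]
    rw [← mul_assoc, ← mul_assoc, ← D.tmul_ribbon_central, mul_assoc, mul_assoc] at h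
    refine (left_inv_eq_right_inv (a := v ⊗ₜ[ℂ] v) ?_ h).symm
    rw [Algebra.TensorProduct.tmul_mul_tmul, D.inv_mul, Algebra.TensorProduct.one_def]
  pivotal_mul_inv := D.pivotal_mul_inv
  pivotal_inv_mul := D.pivotal_inv_mul
  comul_pivotal := D.comul_pivotal
  comul_pivotal_inv := D.comul_pivotal_inv
  antipode_pivotal := D.antipode_pivotal
  antipode_pivotal_inv := D.antipode_pivotal_inv
  antipode_sq := D.antipode_sq
  drinfeld := by
    have h := congrArg (LinearMap.mul' ℂ H ∘ₗ LinearMap.rTensor H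
      (HopfAlgebra.antipode ℂ (A := H) ∘ₗ HopfAlgebra.antipode ℂ (A := H)))
      (D.sum_antipode_tmul_antipode D.antipodeInverse)
    simp only [map_sum, LinearMap.comp_apply, LinearMap.rTensor_tmul, LinearMap.mul'_apply] at h
    rw [← h]
    have h₁ := congrArg (HopfAlgebra.antipode ℂ) D.sum_mul_antipode_sq
    simp only [map_sum, HopfAlgebra.antipode_mul_antidistrib, D.antipode_inv,
      D.antipode_pivotal_inv] at h₁
    rw [← D.inv_central, ← h₁]

section Integral

variable {μ : Module.Dual ℂ H} (hμ : ∀ x : H, applyRight μ (Δ x) = μ x • (1 : H))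
  (hinj : Function.Injective fun β : Module.Dual ℂ H =>
    applyRight β ((∑ i, b i ⊗ₜ[ℂ] a i) * ∑ i, a i ⊗ₜ[ℂ] b i))
include hμ

theorem integral_inv_mul : ∑ i, ∑ j, μ (w * (a i * b j)) • (b i * a j) = μ w • v := by
  have h := congrArg (fun t => applyRight μ ((1 ⊗ₜ w) * t)) D.swap_mul_self
  have e : ((1 : H) ⊗ₜ[ℂ] w) * ((v ⊗ₜ v) * Δ w) = (v ⊗ₜ 1) * Δ w := by
    rw [← mul_assoc, Algebra.TensorProduct.tmul_mul_tmul, one_mul, D.inv_mul]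
  rw [e, applyRight_mul_left, hμ, Finset.sum_mul_sum] at h
  simpa [Finset.mul_sum] using h

omit hμ in
include hinj in
theorem applyRight_comul_inv_injective :
    Function.Injective fun β : Module.Dual ℂ H => applyRight β (Δ w) := fun β γ h => by
  have e : ∀ β : Module.Dual ℂ H, applyRight (β ∘ₗ LinearMap.mulLeft ℂ w)
      ((∑ i, b i ⊗ₜ[ℂ] a i) * ∑ i, a i ⊗ₜ[ℂ] b i) = v * applyRight β (Δ w) := fun β => by
    rw [D.swap_mul_self, applyRight_comp_mulLeft, ← mul_assoc,
      Algebra.TensorProduct.tmul_mul_tmul, one_mul, D.inv_mul, applyRight_mul_left]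
  have h' : β ∘ₗ LinearMap.mulLeft ℂ w = γ ∘ₗ LinearMap.mulLeft ℂ w :=
    hinj (by simp only [e]; exact congrArg (v * ·) h)
  ext x
  have := LinearMap.congr_fun h' (v * x)
  simpa [← mul_assoc, D.inv_mul] using this

include hinj

theorem integral_pivotal_conj (x : H) : μ (k * x * g) = μ x := by
  have hcomm : Δ w * (g ⊗ₜ g) = (g ⊗ₜ g) * Δ w := by
    rw [← D.comul_pivotal, ← Bialgebra.comul_mul, ← Bialgebra.comul_mul, D.inv_central]
  have h : (μ ∘ₗ LinearMap.mulLeft ℂ k) ∘ₗ LinearMap.mulRight ℂ g = μ := by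
    refine D.applyRight_comul_inv_injective hinj ?_
    have e : ((1 : H) ⊗ₜ[ℂ] k) * (Δ w * (1 ⊗ₜ g)) = (g ⊗ₜ 1) * Δ w * (k ⊗ₜ 1) := by
      have e₁ : (1 : H) ⊗ₜ[ℂ] g = (g ⊗ₜ g) * (k ⊗ₜ 1) := by
        rw [Algebra.TensorProduct.tmul_mul_tmul, D.pivotal_mul_inv, mul_one]
      rw [e₁, ← mul_assoc (Δ w), hcomm, ← mul_assoc, ← mul_assoc,
        Algebra.TensorProduct.tmul_mul_tmul, D.pivotal_inv_mul, one_mul]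
    simp only
    rw [applyRight_comp_mulRight, applyRight_comp_mulLeft, e, applyRight_mul_right,
      applyRight_mul_left, hμ]
    simp [D.pivotal_mul_inv]
  simpa [mul_assoc] using LinearMap.congr_fun h x

theorem integral_mul (x y : H) : μ (x * y) = μ (k * y * g * x) := by
  have h : μ ∘ₗ LinearMap.mulRight ℂ y = μ ∘ₗ LinearMap.mulLeft ℂ (k * y * g) := by
    refine D.applyRight_comul_inv_injective hinj ?_
    simp only
    rw [applyRight_comp_mulRight, applyRight_comp_mulLeft, applyRight_mul_comul hμ,
      applyRight_comul_mul hμ D.antipodeInverse, Bialgebra.comul_mul, Bialgebra.comul_mul,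
      D.comul_pivotal, D.comul_pivotal_inv]
    generalize Δ y = t
    induction t with
    | zero => simp
    | tmul p q =>
      have e₁ : μ (k * q * g * w) = μ (w * q) := by
        rw [← D.inv_central, D.inv_central q, ← D.integral_pivotal_conj hμ hinj (q * w)]
        rw [D.inv_central]
        simp only [mul_assoc, D.inv_central]
      have e₂ : S (k * p * g) = T p := by
        rw [HopfAlgebra.antipode_mul_antidistrib, HopfAlgebra.antipode_mul_antidistrib,
          D.antipode_pivotal, D.antipode_pivotal_inv, ← mul_assoc, D.pivotal_inv_mul_antipode,
          mul_assoc, D.pivotal_inv_mul, mul_one]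
      simp [e₁, e₂]
    | add s t hs ht => simp only [mul_add, add_mul, map_add, hs, ht]
  exact LinearMap.congr_fun h x

theorem integral_ribbon_mul : ∑ i, ∑ j, μ (v * (a i * b j)) • (b i * a j) = μ v • w := by
  have h := D.dual.integral_inv_mul hμ
  have e₁ : ∀ i j, μ (v * (b i * S (a j))) = μ (v * (T (a j) * b i)) := fun i j => by
    rw [← mul_assoc, D.integral_mul hμ hinj, D.pivotal_inv_mul_antipode, mul_assoc (T (a j)),
      D.pivotal_inv_mul, mul_one, ← mul_assoc, ← D.central, mul_assoc]
  simp only [e₁] at h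
  have hT : ∑ j, T (a j) ⊗ₜ[ℂ] b j = ∑ j, a j ⊗ₜ[ℂ] S (b j) := by
    simpa [D.antipodeInverse.left] using (congrArg (LinearMap.rTensor H T)
      (D.sum_antipode_tmul_antipode D.antipodeInverse)).symm
  have hTT : ∑ j, T (a j) ⊗ₜ[ℂ] T (b j) = ∑ j, a j ⊗ₜ[ℂ] b j := by
    simpa [D.antipodeInverse.left] using (congrArg (TensorProduct.map T T)
      (D.sum_antipode_tmul_antipode D.antipodeInverse)).symm
  have h₁ : ∑ i, ∑ j, μ (v * (a j * T (b i))) • (a i * S (b j)) = μ v • w := by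
    rw [← h, Finset.sum_comm]
    have e₂ : ∀ j, ∑ i, μ (v * (T (a j) * b i)) • (S (a i) * b j)
        = ∑ i, μ (v * (T (a j) * T (b i))) • (a i * b j) := fun j => by
      simpa [mul_assoc] using congrArg (LinearMap.mulRight ℂ (b j) ∘ₗ
        applyRight (μ ∘ₗ LinearMap.mulLeft ℂ (v * T (a j))))
        (D.sum_antipode_tmul_eq D.antipodeInverse)
    have e₃ : ∀ i, ∑ j, μ (v * (T (a j) * T (b i))) • (a i * b j)
        = ∑ j, μ (v * (a j * T (b i))) • (a i * S (b j)) := fun i => by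
      simpa using congrArg (LinearMap.mulLeft ℂ (a i) ∘ₗ
        applyRight (μ ∘ₗ LinearMap.mulLeft ℂ v ∘ₗ LinearMap.mulRight ℂ (T (b i))) ∘ₗ
        (TensorProduct.comm ℂ H H).toLinearMap) hT
    rw [Finset.sum_comm, eq_comm, Finset.sum_comm]
    simp only [e₂]
    rw [Finset.sum_comm]
    simp only [e₃]
  have h₂ := congrArg T h₁
  simp only [map_sum, map_smul, D.antipodeInverse.map_mul, D.antipodeInverse.left,
    D.dual.inv_ribbon] at h₂
  rw [← h₂, eq_comm, Finset.sum_comm]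
  refine Finset.sum_congr rfl fun j _ => ?_
  simpa [mul_assoc] using congrArg (LinearMap.mulLeft ℂ (b j) ∘ₗ
    applyRight (μ ∘ₗ LinearMap.mulLeft ℂ (v * a j))) hTT

end Integral

end IsRibbonDatum

theorem coactLeft_apply (f : Module.Dual ℂ H) (x : H) :
    coactLeft f x = TensorProduct.lid ℂ H (LinearMap.rTensor H f (Δ x)) := by
  rw [coactLeft, LinearMap.comp_apply, LinearMap.comp_apply]
  generalize Δ x = t
  induction t with
  | zero => simp
  | tmul p q => simp
  | add s t hs ht => simp only [map_add, hs, ht]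

theorem coactLeft_coactLeft (β γ : Module.Dual ℂ H) (x : H) :
    coactLeft γ (coactLeft β x) = coactLeft (conv β γ) x := by
  rw [coactLeft_apply β, coactLeft_apply (conv β γ), conv, ← LinearMap.comp_assoc,
    LinearMap.rTensor_comp_apply, ← Coalgebra.coassoc_symm_apply]
  generalize Δ x = t
  induction t with
  | zero => simp
  | add s t hs ht => simp only [map_add, hs, ht]
  | tmul p q =>
    rw [LinearMap.rTensor_tmul, TensorProduct.lid_tmul, map_smul, coactLeft_apply,
      LinearMap.lTensor_tmul]
    generalize Δ q = s
    induction s with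
    | zero => simp
    | tmul q r => simp [smul_smul]
    | add s t hs ht => simp only [TensorProduct.tmul_add, map_add, smul_add, hs, ht]

namespace IsRMatrix

variable {a b : ι → H} (hR : IsRMatrix a b)
include hR

theorem applyRight_conv (β γ : Module.Dual ℂ H) :
    applyRight (conv β γ) ((∑ i, b i ⊗ₜ[ℂ] a i) * ∑ i, a i ⊗ₜ[ℂ] b i)
      = ∑ i, ∑ l, β (a i * b l) •
        (b i * applyRight γ ((∑ i, b i ⊗ₜ[ℂ] a i) * ∑ i, a i ⊗ₜ[ℂ] b i) * a l) := by
  let Φ : H ⊗[ℂ] H →ₗ[ℂ] ℂ := LinearMap.mul' ℂ ℂ ∘ₗ TensorProduct.map β γ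
  have h₁ : ∀ (t : H ⊗[ℂ] H) (y : H), ∑ i, Φ (Δ (a i) * t) • (b i * y)
      = ∑ i, ∑ m, Φ ((a i ⊗ₜ a m) * t) • (b i * b m * y) := fun t y => by
    simpa using congrArg (LinearMap.mulRight ℂ y ∘ₗ (TensorProduct.lid ℂ H).toLinearMap ∘ₗ
      LinearMap.rTensor H (Φ ∘ₗ LinearMap.mulRight ℂ t)) hR.hex₁
  have h₂ : ∀ (t : H ⊗[ℂ] H) (y : H), ∑ j, Φ (t * Δ (b j)) • (y * a j)
      = ∑ j, ∑ l, Φ (t * (b l ⊗ₜ b j)) • (y * (a j * a l)) := fun t y => by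
    simpa using congrArg (LinearMap.mulLeft ℂ y ∘ₗ (TensorProduct.rid ℂ H).toLinearMap ∘ₗ
      LinearMap.lTensor H (Φ ∘ₗ LinearMap.mulLeft ℂ t)) hR.hex₂
  have h₃ : ∀ x y, conv β γ (x * y) = Φ (Δ x * Δ y) := fun x y => by
    rw [← Bialgebra.comul_mul]; rfl
  have h₄ : ∀ p q r s, Φ ((p ⊗ₜ q) * (r ⊗ₜ s)) = β (p * r) * γ (q * s) := fun p q r s => by
    simp [Φ]
  have h₅ : applyRight γ ((∑ i, b i ⊗ₜ[ℂ] a i) * ∑ i, a i ⊗ₜ[ℂ] b i)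
      = ∑ m, ∑ j, γ (a m * b j) • (b m * a j) := by
    simp [Finset.sum_mul_sum]
  rw [h₅]
  calc _ = ∑ i, ∑ j, Φ (Δ (a i) * Δ (b j)) • (b i * a j) := by
        simp [Finset.sum_mul_sum, h₃]
    _ = ∑ j, ∑ i, ∑ m, Φ ((a i ⊗ₜ a m) * Δ (b j)) • (b i * b m * a j) := by
        rw [Finset.sum_comm]
        simp only [h₁]
    _ = ∑ i, ∑ m, ∑ j, ∑ l, Φ ((a i ⊗ₜ a m) * (b l ⊗ₜ b j)) • (b i * b m * (a j * a l)) := by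
        rw [Finset.sum_comm]
        refine Finset.sum_congr rfl fun i _ => ?_
        rw [Finset.sum_comm]
        exact Finset.sum_congr rfl fun m _ => h₂ _ _
    _ = _ := by
        refine Finset.sum_congr rfl fun i _ => ?_
        rw [Finset.sum_congr rfl fun m _ => Finset.sum_comm, Finset.sum_comm]
        refine Finset.sum_congr rfl fun l _ => ?_
        simp only [h₄, Finset.mul_sum, Finset.sum_mul, Finset.smul_sum, mul_smul_comm,
          smul_mul_assoc, smul_smul, mul_assoc]

theorem applyRight_counit : applyRight (ε : H →ₗ[ℂ] ℂ)
    ((∑ i, b i ⊗ₜ[ℂ] a i) * ∑ i, a i ⊗ₜ[ℂ] b i) = 1 := by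
  calc _ = (∑ i, ε (a i) • b i) * (∑ j, ε (b j) • a j) := by
        simp only [Finset.sum_mul_sum, map_sum, Algebra.TensorProduct.tmul_mul_tmul,
          applyRight_tmul, Bialgebra.counit_mul, smul_mul_smul_comm]
    _ = 1 := by rw [hR.sum_counit_left, hR.sum_counit_right, one_mul]

end IsRMatrix

namespace IsRibbonDatum

variable {T : H →ₗ[ℂ] H} {a b : ι → H} {v w g k : H} (D : IsRibbonDatum T a b v w g k)
include D

section Integral

variable {μ : Module.Dual ℂ H} (hμ : ∀ x : H, applyRight μ (Δ x) = μ x • (1 : H))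
  (hinj : Function.Injective fun β : Module.Dual ℂ H =>
    applyRight β ((∑ i, b i ⊗ₜ[ℂ] a i) * ∑ i, a i ⊗ₜ[ℂ] b i))
include hμ hinj

theorem conv_integral : conv (μ ∘ₗ LinearMap.mulLeft ℂ v) (μ ∘ₗ LinearMap.mulLeft ℂ w)
    = (μ v * μ w) • (ε : H →ₗ[ℂ] ℂ) := by
  apply hinj
  have h₁ : applyRight (μ ∘ₗ LinearMap.mulLeft ℂ w)
      ((∑ i, b i ⊗ₜ[ℂ] a i) * ∑ i, a i ⊗ₜ[ℂ] b i) = μ w • v := by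
    rw [← D.integral_inv_mul hμ]
    simp [Finset.sum_mul_sum]
  have h₂ : applyRight ((μ v * μ w) • (ε : H →ₗ[ℂ] ℂ))
      ((∑ i, b i ⊗ₜ[ℂ] a i) * ∑ i, a i ⊗ₜ[ℂ] b i) = (μ v * μ w) • 1 := by
    rw [← D.applyRight_counit]
    simp [Finset.sum_mul_sum, mul_smul, Finset.smul_sum]
  simp only
  rw [D.applyRight_conv, h₁, h₂]
  calc _ = μ w • (v * ∑ i, ∑ j, μ (v * (a i * b j)) • (b i * a j)) := by
        simp only [Finset.mul_sum, Finset.smul_sum]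
        refine Finset.sum_congr rfl fun i _ => Finset.sum_congr rfl fun j _ => ?_
        rw [mul_smul_comm, smul_mul_assoc, ← D.central, mul_smul_comm, smul_comm, mul_assoc]
        rfl
    _ = _ := by
        rw [D.integral_ribbon_mul hμ hinj, mul_smul_comm, D.mul_inv, smul_smul, mul_comm]

theorem coactLeft_coactLeft_integral (x : H) :
    coactLeft (μ ∘ₗ LinearMap.mulLeft ℂ (k * w)) (coactLeft (μ ∘ₗ LinearMap.mulLeft ℂ (k * v)) x)
      = (μ v * μ w) • x := by
  have hk : ε k = 1 := by
    have h := congrArg (TensorProduct.lid ℂ H) (Coalgebra.rTensor_counit_comul (R := ℂ) k)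
    rw [D.comul_pivotal_inv] at h
    simp only [LinearMap.rTensor_tmul, TensorProduct.lid_tmul, one_smul] at h
    have h' := congrArg (fun y => (ε : H →ₗ[ℂ] ℂ) (y * g)) h
    simpa [D.pivotal_inv_mul] using h'
  have hc : ∀ (β γ : Module.Dual ℂ H), conv (β ∘ₗ LinearMap.mulLeft ℂ k)
      (γ ∘ₗ LinearMap.mulLeft ℂ k) = conv β γ ∘ₗ LinearMap.mulLeft ℂ k := fun β γ => by
    ext y
    simp only [conv, LinearMap.comp_apply, LinearMap.mulLeft_apply, Bialgebra.comul_mul,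
      D.comul_pivotal_inv]
    generalize Δ y = t
    induction t with
    | zero => simp
    | tmul p q => simp
    | add s t hs ht => simp only [mul_add, map_add, hs, ht]
  have h : conv (μ ∘ₗ LinearMap.mulLeft ℂ (k * v)) (μ ∘ₗ LinearMap.mulLeft ℂ (k * w))
      = (μ v * μ w) • (ε : H →ₗ[ℂ] ℂ) := by
    rw [← D.central, ← D.inv_central, LinearMap.mulLeft_mul, LinearMap.mulLeft_mul,
      ← LinearMap.comp_assoc, ← LinearMap.comp_assoc, hc, D.conv_integral hμ hinj]
    ext y
    simp [hk]
  rw [coactLeft_coactLeft, h, coactLeft_apply, LinearMap.rTensor_smul, LinearMap.smul_apply,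
    Coalgebra.rTensor_counit_comul]
  simp

end Integral

end IsRibbonDatum

theorem conv_apply (β γ : Module.Dual ℂ H) (x : H) : conv β γ x = γ (coactLeft β x) := by
  rw [coactLeft_apply, conv, LinearMap.comp_apply, LinearMap.comp_apply]
  generalize Δ x = t
  induction t with
  | zero => simp
  | tmul p q => simp
  | add s t hs ht => simp only [map_add, hs, ht]

namespace IsRibbonDatum

variable {T : H →ₗ[ℂ] H} {a b : ι → H} {v w g k : H} (D : IsRibbonDatum T a b v w g k)
include D

theorem sum_inv_mul_double_braiding_mul :
    ∑ l, (T (a l) ⊗ₜ[ℂ] (1 : H)) * ((∑ i, a i ⊗ₜ[ℂ] b i) * ∑ i, b i ⊗ₜ[ℂ] a i)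
        * (b l ⊗ₜ[ℂ] (1 : H))
      = ∑ n, ((v * a n * k) ⊗ₜ[ℂ] (1 : H)) * (∑ i, b i ⊗ₜ[ℂ] a i) * ((1 : H) ⊗ₜ[ℂ] b n) := by
  set R := ∑ i, a i ⊗ₜ[ℂ] b i
  set R' := ∑ i, b i ⊗ₜ[ℂ] a i
  have hcomm : ∀ h : H, R * R' * TensorProduct.comm ℂ H H (Δ h)
      = TensorProduct.comm ℂ H H (Δ h) * (R * R') := fun h => by
    rw [mul_assoc, D.swap_comm, ← mul_assoc, D.comm, mul_assoc]
  have h₁ : ∑ i, a i ⊗ₜ[ℂ] TensorProduct.comm ℂ H H (Δ (b i))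
      = ∑ i, ∑ j, (a i * a j) ⊗ₜ[ℂ] (b i ⊗ₜ[ℂ] b j) := by
    simpa using congrArg (LinearMap.lTensor H (TensorProduct.comm ℂ H H).toLinearMap) D.hex₂
  have h₂ : ∀ n, ∑ l, ∑ m, ((a n * (T (a m) * T (a l))) ⊗ₜ[ℂ] (1 : H))
        * (R * R' * (b l ⊗ₜ b m)) * (1 ⊗ₜ b n)
      = ∑ l, ∑ m, ((a n * (T (a m) * T (a l))) ⊗ₜ[ℂ] (1 : H))
        * ((b l ⊗ₜ b m) * (R * R')) * (1 ⊗ₜ b n) := fun n => by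
    let Φ (L : H ⊗[ℂ] H →ₗ[ℂ] H ⊗[ℂ] H) : H ⊗[ℂ] (H ⊗[ℂ] H) →ₗ[ℂ] H ⊗[ℂ] H :=
      LinearMap.mulRight ℂ (1 ⊗ₜ b n) ∘ₗ LinearMap.mul' ℂ (H ⊗[ℂ] H) ∘ₗ TensorProduct.map
        ((TensorProduct.mk ℂ H H).flip 1 ∘ₗ LinearMap.mulLeft ℂ (a n) ∘ₗ T) L
    have e₁ := congrArg (Φ (LinearMap.mulLeft ℂ (R * R'))) h₁
    have e₂ := congrArg (Φ (LinearMap.mulRight ℂ (R * R'))) h₁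
    simp only [Φ, map_sum, LinearMap.comp_apply, TensorProduct.map_tmul, LinearMap.mul'_apply,
      LinearMap.mulLeft_apply, LinearMap.mulRight_apply, LinearMap.flip_apply,
      TensorProduct.mk_apply, D.antipodeInverse.map_mul, hcomm] at e₁ e₂
    rw [← e₁, ← e₂]
  have h₃ : ∀ l, ∑ n, ∑ m, ((a n * (T (a m) * T (a l))) ⊗ₜ[ℂ] (1 : H))
        * (R * R' * (b l ⊗ₜ b m)) * (1 ⊗ₜ b n) = (T (a l) ⊗ₜ 1) * (R * R') * (b l ⊗ₜ 1) :=
      fun l => by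
    have e := congrArg (LinearMap.mul' ℂ (H ⊗[ℂ] H) ∘ₗ TensorProduct.map
      (LinearMap.mulRight ℂ (R * R' * (b l ⊗ₜ 1)) ∘ₗ (TensorProduct.mk ℂ H H).flip 1 ∘ₗ
        LinearMap.mulRight ℂ (T (a l))) (TensorProduct.mk ℂ H H 1))
      (D.sum_mul_inv D.antipodeInverse)
    simp only [map_sum, LinearMap.comp_apply, TensorProduct.map_tmul, LinearMap.mul'_apply,
      LinearMap.mulRight_apply, LinearMap.flip_apply, TensorProduct.mk_apply,
      Algebra.TensorProduct.one_def, one_mul] at e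
    rw [mul_assoc, ← mul_one ((T (a l) ⊗ₜ[ℂ] (1 : H)) * _), Algebra.TensorProduct.one_def, ← e]
    refine Finset.sum_congr rfl fun n _ => Finset.sum_congr rfl fun m _ => ?_
    simp only [mul_assoc, Algebra.TensorProduct.tmul_mul_tmul, one_mul, mul_one]
  have h₄ : ∀ n, ∑ l, ∑ m, ((a n * (T (a m) * T (a l))) ⊗ₜ[ℂ] (1 : H))
        * ((b l ⊗ₜ b m) * (R * R')) * (1 ⊗ₜ b n)
      = ((v * a n * k) ⊗ₜ 1) * R' * (1 ⊗ₜ b n) := fun n => by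
    have e₁ : ∀ m, ∑ l, ((a n * (T (a m) * T (a l))) ⊗ₜ[ℂ] (1 : H)) * (b l ⊗ₜ b m)
        = ((v * a n * k) ⊗ₜ 1) * (S (a m) ⊗ₜ b m) := fun m => by
      simp only [Algebra.TensorProduct.tmul_mul_tmul, one_mul]
      rw [← TensorProduct.sum_tmul]
      congr 1
      simp only [mul_assoc]
      rw [← Finset.mul_sum, ← Finset.mul_sum, D.sum_inv_mul, D.pivotal_inv_mul_antipode,
        D.central (a n * _)]
      simp only [mul_assoc]
    rw [Finset.sum_comm]
    simp only [← mul_assoc] at e₁ ⊢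
    simp only [← Finset.sum_mul, e₁]
    rw [← Finset.mul_sum, mul_assoc _ _ R, D.antipode_left_mul_self, mul_one]
  calc _ = ∑ n, ∑ l, ∑ m, ((a n * (T (a m) * T (a l))) ⊗ₜ[ℂ] (1 : H))
        * (R * R' * (b l ⊗ₜ b m)) * (1 ⊗ₜ b n) := by
        rw [Finset.sum_comm]
        simp only [h₃]
    _ = _ := by simp only [h₂, h₄]

section Integral

variable {μ : Module.Dual ℂ H} (hμ : ∀ x : H, applyRight μ (Δ x) = μ x • (1 : H))
  (hinj : Function.Injective fun β : Module.Dual ℂ H =>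
    applyRight β ((∑ i, b i ⊗ₜ[ℂ] a i) * ∑ i, a i ⊗ₜ[ℂ] b i))
include hμ hinj

theorem antipode_coactLeft_integral (z : H) :
    v * k * S (coactLeft (μ ∘ₗ LinearMap.mulLeft ℂ (k * w)) (v * z))
      = ∑ i, ∑ j, μ (k * (b i * a j * z)) • (a i * b j) := by
  have e : ∀ i j, v * k * S (w * b i * k * S (a j)) = a j * S (b i) := fun i j => by
    simp only [HopfAlgebra.antipode_mul_antidistrib, D.antipode_inv, D.antipode_pivotal_inv]
    rw [← mul_assoc (S (S (a j))), D.antipode_sq, mul_assoc v k, ← mul_assoc k, ← mul_assoc k,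
      D.pivotal_inv_mul, one_mul, ← D.inv_central,
      ← mul_assoc v, D.central, mul_assoc, ← mul_assoc v, D.mul_inv, one_mul]
  rw [D.dual.coactLeft_integral hμ]
  simp only [map_sum, map_smul, Finset.mul_sum, mul_smul_comm, e]
  rw [Finset.sum_comm]
  refine Finset.sum_congr rfl fun l _ => ?_
  have h := congrArg (LinearMap.mulLeft ℂ (a l) ∘ₗ applyRight (μ ∘ₗ LinearMap.mulLeft ℂ k ∘ₗ
    LinearMap.mulRight ℂ (z * b l)) ∘ₗ (TensorProduct.comm ℂ H H).toLinearMap)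
    (D.sum_antipode_tmul_antipode D.antipodeInverse)
  simp only [map_sum, LinearMap.comp_apply, LinearEquiv.coe_coe, TensorProduct.comm_tmul,
    applyRight_tmul, LinearMap.mulLeft_apply, LinearMap.mulRight_apply, mul_smul_comm,
    ← mul_assoc] at h
  rw [h]
  refine Finset.sum_congr rfl fun i _ => ?_
  rw [D.integral_mul hμ hinj, mul_assoc _ g]
  simp only [← mul_assoc]
  rw [mul_assoc (k * b l), D.pivotal_mul_inv, mul_one]

theorem coactLeft_integral_eq_sum (z : H) :
    coactLeft (μ ∘ₗ LinearMap.mulLeft ℂ (k * v)) (w * z) = ∑ i, T (a i) *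
      (v * k * S (coactLeft (μ ∘ₗ LinearMap.mulLeft ℂ (k * w)) (v * z))) * b i := by
  have h := congrArg (applyRight (μ ∘ₗ LinearMap.mulLeft ℂ k ∘ₗ LinearMap.mulRight ℂ z))
    D.sum_inv_mul_double_braiding_mul
  simp only [map_sum, applyRight_mul_right, applyRight_mul_left] at h
  rw [D.antipode_coactLeft_integral hμ hinj, D.coactLeft_integral hμ]
  have e : ∀ i j, μ (k * b i * z * a j) = μ (k * (a j * b i * z)) := fun i j => by
    rw [D.integral_mul hμ hinj]
    congr 1
    simp only [← mul_assoc]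
    rw [mul_assoc (k * a j), D.pivotal_mul_inv, mul_one]
  simp only [e]
  simp only [Finset.sum_mul, Finset.mul_sum, map_sum, Algebra.TensorProduct.tmul_mul_tmul, one_mul,
    mul_one, applyRight_tmul, LinearMap.comp_apply, LinearMap.mulLeft_apply,
    LinearMap.mulRight_apply, mul_smul_comm, smul_mul_assoc] at h ⊢
  rw [← h]
  exact Finset.sum_congr rfl fun i _ => Finset.sum_comm

end Integral

end IsRibbonDatum

end RMatrix

theorem TaTbTa_squared_formula
    {H : Type} [Ring H] [HopfAlgebra ℂ H] [FiniteDimensional ℂ H]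
    -- the antipode is invertible
    (Sinv : H →ₗ[ℂ] H)
    (hSinv₁ : ∀ x : H, Sinv (HopfAlgebra.antipode (R := ℂ) x) = x)
    (hSinv₂ : ∀ x : H, HopfAlgebra.antipode (R := ℂ) (Sinv x) = x)
    -- an invertible R-matrix `R = Σᵢ aᵢ ⊗ bᵢ`
    {ι : Type} [Fintype ι] (aR bR : ι → H)
    (hRinv : IsUnit (∑ i, aR i ⊗ₜ[ℂ] bR i : H ⊗[ℂ] H))
    -- `R Δ(x) = Δᵒᵖ(x) R`
    (hRΔ : ∀ x : H,
      (∑ i, aR i ⊗ₜ[ℂ] bR i) * Coalgebra.comul (R := ℂ) x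
        = (TensorProduct.comm ℂ H H) (Coalgebra.comul (R := ℂ) x)
            * ∑ i, aR i ⊗ₜ[ℂ] bR i)
    -- `(Δ ⊗ id)(R) = R₁₃ R₂₃`
    (hR₁ : (∑ i, (Coalgebra.comul (R := ℂ) (aR i)) ⊗ₜ[ℂ] bR i)
        = ∑ i, ∑ j, (aR i ⊗ₜ[ℂ] aR j) ⊗ₜ[ℂ] (bR i * bR j))
    -- `(id ⊗ Δ)(R) = R₁₃ R₁₂`
    (hR₂ : (∑ i, aR i ⊗ₜ[ℂ] (Coalgebra.comul (R := ℂ) (bR i)))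
        = ∑ i, ∑ j, (aR i * aR j) ⊗ₜ[ℂ] (bR j ⊗ₜ[ℂ] bR i))
    -- a ribbon element `v`
    (v vinv : H) (hv₁ : v * vinv = 1) (hv₂ : vinv * v = 1)
    (hvcentral : ∀ x : H, v * x = x * v)
    (hSv : HopfAlgebra.antipode (R := ℂ) v = v)
    (hεv : Coalgebra.counit (R := ℂ) v = 1)
    -- `Δ(v) = (R'R)⁻¹ (v ⊗ v)`, i.e. `R' R Δ(v) = v ⊗ v`
    (hΔv : (∑ i, bR i ⊗ₜ[ℂ] aR i) * ((∑ i, aR i ⊗ₜ[ℂ] bR i)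
            * Coalgebra.comul (R := ℂ) v) = v ⊗ₜ[ℂ] v)
    -- factorizability: `β ↦ (β ⊗ id)(RR')` is bijective
    (hfact : Function.Bijective fun β : Module.Dual ℂ H =>
        ∑ i, ∑ j, β (aR i * bR j) • (bR i * aR j))
    -- the pivotal element `g = u v⁻¹`, where `u = Σᵢ S(bᵢ) aᵢ` is the Drinfeld element;
    -- `g` is invertible, grouplike and implements `S²`
    (g gi : H)
    (hg : g = (∑ i, HopfAlgebra.antipode (R := ℂ) (bR i) * aR i) * vinv)
    (hgi₁ : g * gi = 1) (hgi₂ : gi * g = 1)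
    (hggrouplike : Coalgebra.comul (R := ℂ) g = g ⊗ₜ[ℂ] g)
    (hgS₂ : ∀ x : H,
      HopfAlgebra.antipode (R := ℂ) (HopfAlgebra.antipode (R := ℂ) x) * g = g * x)
    -- a left integral `μˡ`, with `μˡ(v) ≠ 0` and `μˡ(v⁻¹) ≠ 0`
    (μl : Module.Dual ℂ H) (hμl0 : μl ≠ 0)
    (hμl : ∀ x : H, (TensorProduct.rid ℂ H)
        ((LinearMap.lTensor H μl) (Coalgebra.comul (R := ℂ) x)) = μl x • (1 : H))
    (hμlv : μl v ≠ 0) (hμlvinv : μl vinv ≠ 0)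
    :
    ∀ (φ : Module.Dual ℂ H) (x : H),
      ((Ta vinv ∘ Tb μl v vinv gi ∘ Ta vinv)
        ((Ta vinv ∘ Tb μl v vinv gi ∘ Ta vinv) φ)) x
      = (μl vinv / μl v)
          * ∑ i, φ (Sinv (aR i) * gi * vinv * HopfAlgebra.antipode (R := ℂ) x * bR i) := by
  intro φ x
  have hμ : ∀ x : H, applyRight μl (Coalgebra.comul (R := ℂ) x) = μl x • (1 : H) := hμl
  have hgrouplike : ∀ y : H, Coalgebra.comul (R := ℂ) y = y ⊗ₜ[ℂ] y → ∀ z : H, z * y = 1 →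
      y * z = 1 → HopfAlgebra.antipode ℂ y = z := fun y hy z hzy hyz => by
    have hε : Coalgebra.counit (R := ℂ) y = 1 := by
      have h := congrArg (TensorProduct.lid ℂ H) (Coalgebra.rTensor_counit_comul (R := ℂ) y)
      rw [hy, LinearMap.rTensor_tmul, TensorProduct.lid_tmul, TensorProduct.lid_tmul,
        one_smul] at h
      simpa [hyz] using congrArg (fun t => Coalgebra.counit (R := ℂ) (t * z)) h
    have h := HopfAlgebra.mul_antipode_rTensor_comul_apply (R := ℂ) y
    rw [hy, hε] at h
    exact left_inv_eq_right_inv (by simpa using h) hyz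
  have hgi : Coalgebra.comul (R := ℂ) gi = gi ⊗ₜ[ℂ] gi := by
    refine left_inv_eq_right_inv (a := Coalgebra.comul (R := ℂ) g) ?_ ?_
    · rw [← Bialgebra.comul_mul, hgi₂, Bialgebra.comul_one]
    · rw [hggrouplike, Algebra.TensorProduct.tmul_mul_tmul, hgi₁, Algebra.TensorProduct.one_def]
  have D : IsRibbonDatum Sinv aR bR v vinv g gi :=
    { isUnit := hRinv
      comm := hRΔ
      hex₁ := hR₁
      hex₂ := hR₂
      antipodeInverse := ⟨hSinv₁, hSinv₂⟩
      mul_inv := hv₁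
      inv_mul := hv₂
      central := hvcentral
      antipode_ribbon := hSv
      ribbon := hΔv
      pivotal_mul_inv := hgi₁
      pivotal_inv_mul := hgi₂
      comul_pivotal := hggrouplike
      comul_pivotal_inv := hgi
      antipode_pivotal := hgrouplike g hggrouplike gi hgi₂ hgi₁
      antipode_pivotal_inv := hgrouplike gi hgi g hgi₁ hgi₂
      antipode_sq := hgS₂
      drinfeld := by rw [hg, mul_assoc, hv₂, mul_one] }
  have hinj : Function.Injective fun β : Module.Dual ℂ H =>
      applyRight β ((∑ i, bR i ⊗ₜ[ℂ] aR i) * ∑ i, aR i ⊗ₜ[ℂ] bR i) := by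
    simpa [Finset.sum_mul_sum] using hfact.injective
  have hTbTa : ∀ (ψ : Module.Dual ℂ H) (y : H),
      ((Ta vinv ∘ Tb μl v vinv gi ∘ Ta vinv) ψ) y = (μl v)⁻¹ *
        ψ (coactLeft (μl ∘ₗ LinearMap.mulLeft ℂ (gi * v)) (vinv * (vinv * y))) := fun ψ y => by
    simp only [Function.comp_apply, Ta, Tb, LinearMap.comp_apply, LinearMap.smul_apply,
      LinearMap.mulLeft_apply, conv_apply, smul_eq_mul]
    rw [← mul_assoc vinv v, hv₂, one_mul]
  rw [hTbTa, hTbTa, D.coactLeft_integral_eq_sum hμ hinj, ← mul_assoc v vinv, hv₁, one_mul,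
    D.coactLeft_coactLeft_integral hμ hinj]
  have e : ∀ i, Sinv (aR i) * (v * gi * HopfAlgebra.antipode ℂ ((μl v * μl vinv) •
      (vinv * (vinv * x)))) * bR i = (μl v * μl vinv) •
        (Sinv (aR i) * gi * vinv * HopfAlgebra.antipode (R := ℂ) x * bR i) := fun i => by
    rw [map_smul, HopfAlgebra.antipode_mul_antidistrib, HopfAlgebra.antipode_mul_antidistrib,
      D.antipode_inv, ← D.inv_central, ← D.inv_central, hvcentral gi, mul_smul_comm,
      mul_smul_comm, smul_mul_assoc, mul_assoc gi, ← mul_assoc v vinv, hv₁, one_mul]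
    simp only [mul_assoc]
  simp only [map_sum, e]
  simp only [map_smul, smul_eq_mul, ← Finset.mul_sum]
  field_simp

end
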